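/- Fix n ≥ 1 and p ∈ (0,1). For any ε ∈ (0, p), E[C(x^rand)] ≥ (1 − e^{−2ε²n}) · H_{⌈(1−p+ε)n⌉} / (2⌈(1−p+ε)n⌉). Moreover, for any ε ∈ (0, 1−p), E[C(x^rand)] ≤ e^{−2ε²n} + (H_{⌈(1−p−ε)n⌉} + 4)/(2⌈(1−p−ε)n⌉ + 2). -/

import Mathlib

open Finset MeasureTheory

/-- Coverage cost on the line `[0,1]` for placement `x` and active set `A`:
the largest distance from a point of `[0,1]` to the closest active sensor
(`1` by convention if `A = ∅`). -/
noncomputable def cost0 {n : ℕ} (x : Fin n → ℝ) (A : Finset (Fin n)) : ℝ :=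
  if A.Nonempty then ⨆ s : Set.Icc (0:ℝ) 1, ⨅ j : A, |s.1 - x j.1| else 1

/-- Probability that `A` is the active set, under independent failures with
probability `p`. -/
noncomputable def prob {n : ℕ} (p : ℝ) (A : Finset (Fin n)) : ℝ :=
  p ^ (n - A.card) * (1 - p) ^ A.card

/-- Expected coverage cost `C(x)` under independent failures with probability `p`. -/
noncomputable def expCost {n : ℕ} (p : ℝ) (x : Fin n → ℝ) : ℝ :=
  ∑ A : Finset (Fin n), prob p A * cost0 x A

/-- The equispaced placement `x^eq`, whose `i`-th entry (`i = 0, …, n-1`) is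
`(2i+1)/(2n)`. -/
noncomputable def xeq (n : ℕ) : Fin n → ℝ := fun i => (2 * (i : ℝ) + 1) / (2 * n)

/-- The `k`-th smallest element of the finite set `A` (0-based). -/
noncomputable def nth {n : ℕ} (A : Finset (Fin n)) (k : Fin A.card) : Fin n :=
  (A.orderIsoOfFin rfl k).1

/-- Coverage cost on the circle of circumference 1 for the active set `A`. -/
noncomputable def ccost0 {n : ℕ} (x : Fin n → ℝ) (A : Finset (Fin n)) : ℝ :=
  if A.Nonempty then
    ⨆ s : Set.Icc (0:ℝ) 1, ⨅ j : A, min |s.1 - x j.1| (1 - |s.1 - x j.1|)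
  else 1

/-- Expected circle coverage cost `C̃(x)`. -/
noncomputable def cExpCost {n : ℕ} (p : ℝ) (x : Fin n → ℝ) : ℝ :=
  ∑ A : Finset (Fin n), prob p A * ccost0 x A

/-- Harmonic number `H_m = ∑_{h=1}^m 1/h`. -/
noncomputable def H (m : ℕ) : ℝ := ∑ i ∈ Finset.range m, 1 / ((i : ℝ) + 1)

/-- Length of the longest run of consecutive indices of `{0, …, n-1}` not
belonging to `A`. -/
noncomputable def longestRun {n : ℕ} (A : Finset (Fin n)) : ℕ :=
  sSup {r : ℕ | ∃ a : ℕ, a + r ≤ n ∧ ∀ i : Fin n, a ≤ i.1 → i.1 < a + r → i ∉ A}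

/-- Expected cost in the Cortés (constant-number-of-failures) model where
exactly `k` sensors fail, uniformly at random. -/
noncomputable def cortesCost {n : ℕ} (k : ℕ) (x : Fin n → ℝ) : ℝ :=
  (n.choose k : ℝ)⁻¹ *
    ∑ A ∈ Finset.univ.filter (fun A : Finset (Fin n) => A.card = n - k), cost0 x A

/-- Expectation over the random uniform i.i.d. placement `x^rand ∈ [0,1]^n`
of the expected cost `C(x^rand)`. -/
noncomputable def randExp (n : ℕ) (p : ℝ) : ℝ :=
  ∫ x in Set.univ.pi (fun _ : Fin n => Set.Icc (0:ℝ) 1), expCost p x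

/-- `E[C_0(x^{rand,m})]`: expected coverage cost of `m` i.i.d. uniform sensors,
all active. -/
noncomputable def randCost0 (m : ℕ) : ℝ :=
  ∫ x in Set.univ.pi (fun _ : Fin m => Set.Icc (0:ℝ) 1), cost0 x Finset.univ

/-- `E[C^{k,n}(x^rand)]`: expectation over the random placement of the Cortés
model cost. -/
noncomputable def randCortes (n k : ℕ) : ℝ :=
  ∫ x in Set.univ.pi (fun _ : Fin n => Set.Icc (0:ℝ) 1), cortesCost k x

/-- The placements whose sensors outside `A` lie in `(0, 1]`, whose sensors in `A` are distinct and
lie in `(a, b]`, and such that every sensor of `S` is followed by a stretch of length `t` inside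
`(a, b]` that contains no sensor of `A`. -/
def gapSet {n : ℕ} (A S : Finset (Fin n)) (a b t : ℝ) : Set (Fin n → ℝ) :=
  {x | Set.InjOn x A ∧ (∀ j ∉ A, x j ∈ Set.Ioc (0:ℝ) 1) ∧ (∀ j ∈ A, x j ∈ Set.Ioc a b) ∧
    ∀ i ∈ S, x i + t ≤ b ∧ ∀ j ∈ A, x i < x j → x i + t < x j}

lemma ae_injective {n : ℕ} : ∀ᵐ x : Fin n → ℝ, Function.Injective x := by
  have h : ∀ i j : Fin n, ∀ᵐ x : Fin n → ℝ, x i = x j → i = j := by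
    intro i j
    by_cases hij : i = j
    · simp [hij]
    let φ : (Fin n → ℝ) →ₗ[ℝ] ℝ :=
      LinearMap.proj (R := ℝ) (φ := fun _ => ℝ) i - LinearMap.proj (R := ℝ) (φ := fun _ => ℝ) j
    have hφ : ∀ x, φ x = x i - x j := fun x => rfl
    have h0 : volume (LinearMap.ker φ : Set (Fin n → ℝ)) = 0 := by
      refine Measure.addHaar_submodule volume _ fun h => ?_
      have h1 : (Pi.single i 1 : Fin n → ℝ) ∈ LinearMap.ker φ := h ▸ Submodule.mem_top
      simp [hφ, Ne.symm hij] at h1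
    rw [ae_iff]
    convert h0 using 2
    ext x
    simp [hij, hφ, sub_eq_zero]
  filter_upwards [ae_all_iff.2 fun i => ae_all_iff.2 fun j => h i j] with x hx i j
  exact hx i j

lemma measurableSet_gapSet {n : ℕ} (A S : Finset (Fin n)) (a b t : ℝ) :
    MeasurableSet (gapSet A S a b t) := by
  have h1 : MeasurableSet {x : Fin n → ℝ | Set.InjOn x A} := by
    simp only [Set.InjOn]
    measurability
  have h2 : MeasurableSet {x : Fin n → ℝ | ∀ j ∉ A, x j ∈ Set.Ioc (0:ℝ) 1} := by measurability
  have h3 : MeasurableSet {x : Fin n → ℝ | ∀ j ∈ A, x j ∈ Set.Ioc a b} := by measurability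
  have h4 : MeasurableSet {x : Fin n → ℝ |
      ∀ i ∈ S, x i + t ≤ b ∧ ∀ j ∈ A, x i < x j → x i + t < x j} := by measurability
  exact h1.inter (h2.inter (h3.inter h4))

lemma volume_gapSet_empty {n : ℕ} (A : Finset (Fin n)) (a b t : ℝ) :
    volume (gapSet A ∅ a b t) = ENNReal.ofReal (b - a) ^ A.card := by
  have : gapSet A ∅ a b t =ᵐ[volume] Set.univ.pi
      fun j => if j ∈ A then Set.Ioc a b else Set.Ioc (0:ℝ) 1 := by
    filter_upwards [ae_injective] with x hx
    apply propext
    change x ∈ gapSet _ _ _ _ _ ↔ x ∈ Set.univ.pi _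
    simp only [gapSet, hx.injOn, Set.mem_ofPred_eq, Set.mem_pi, Set.mem_univ, true_and, true_imp_iff]
    constructor
    · rintro ⟨h1, h2, -⟩ j
      split_ifs with h
      · exact h2 j h
      · exact h1 j h
    · intro h
      refine ⟨fun j hj => ?_, fun j hj => ?_, by simp⟩
      · simpa [hj] using h j
      · simpa [hj] using h j
  rw [measure_congr this, volume_pi_pi]
  simp [apply_ite]

lemma volume_gapSet_insert {n : ℕ} {A S : Finset (Fin n)} {i : Fin n} (hS : S ⊆ A) (hiA : i ∈ A)
    (hi : i ∉ S) (a b : ℝ) {t : ℝ} (ht : 0 < t) :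
    volume (gapSet A (insert i S) a b t) = volume (gapSet A S a (b - t) t) := by
  classical
  let f : (Fin n → ℝ) → Finset (Fin n) := fun x => {j ∈ A | x i < x j}
  have hf : ∀ T, MeasurableSet (f ⁻¹' {T}) := by
    intro T
    simp only [f, Set.preimage, Set.mem_singleton_iff, Finset.ext_iff, mem_filter]
    measurability
  have key : ∀ s : Set (Fin n → ℝ), MeasurableSet s →
      volume s = ∑ T, volume (f ⁻¹' {T} ∩ s) := by
    intro s hs
    have := sum_measure_preimage_singleton (μ := volume.restrict s) univ (f := f) (fun T _ => hf T)
    simp only [coe_univ, Set.preimage_univ, Measure.restrict_apply_univ] at this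
    rw [← this]
    exact sum_congr rfl fun T _ => Measure.restrict_apply (hf T)
  rw [key _ (measurableSet_gapSet ..), key _ (measurableSet_gapSet ..)]
  refine sum_congr rfl fun T _ => ?_
  refine Eq.trans ?_ (measure_preimage_add_right volume (fun j => if j ∈ T then -t else 0)
    (f ⁻¹' {T} ∩ gapSet A S a (b - t) t))
  congr 1
  ext x
  rw [Set.mem_preimage]
  set y : Fin n → ℝ := x + fun j => if j ∈ T then -t else 0 with hy
  have hyT : ∀ j ∈ T, y j = x j - t := by
    intro j hj
    simp [hy, hj, sub_eq_add_neg]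
  have hyN : ∀ j ∉ T, y j = x j := by
    intro j hj
    simp [hy, hj]
  clear_value y
  clear hy
  have hmem : ∀ z, f z = T ↔ ∀ j, (j ∈ A ∧ z i < z j) ↔ j ∈ T := by
    simp [f, Finset.ext_iff]
  simp only [Set.mem_inter_iff, Set.mem_preimage, Set.mem_singleton_iff, hmem, gapSet,
    Set.mem_ofPred_eq, Set.InjOn, Set.mem_Ioc, mem_insert, forall_eq_or_imp, mem_coe]
  have hle : ∀ z : Fin n → ℝ, (∀ j, (j ∈ A ∧ z i < z j) ↔ j ∈ T) →
      i ∉ T ∧ (∀ j ∈ T, j ∈ A ∧ z i < z j) ∧ ∀ j ∈ A, j ∉ T → z j ≤ z i := by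
    intro z hz
    refine ⟨fun h => lt_irrefl _ ((hz i).2 h).2, fun j hj => (hz j).2 hj, fun j hj hjT => ?_⟩
    by_contra! h
    exact hjT ((hz j).1 ⟨hj, h⟩)
  constructor
  · rintro ⟨hf, hinj, hfree, hbox, ⟨hib, higap⟩, hgap⟩
    obtain ⟨hiT, hT, hN⟩ := hle x hf
    have hyi := hyN i hiT
    refine ⟨fun j => ⟨?_, ?_⟩, ?_, ?_, ?_, ?_⟩ <;> grind
  · rintro ⟨hf, hinj, hfree, hbox, hgap⟩
    obtain ⟨hiT, hT, hN⟩ := hle y hf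
    have hyi := hyN i hiT
    refine ⟨fun j => ⟨?_, ?_⟩, ?_, ?_, ?_, ?_, ?_⟩ <;> grind

lemma volume_gapSet {n : ℕ} {A S : Finset (Fin n)} (hS : S ⊆ A) (a b : ℝ) {t : ℝ} (ht : 0 < t) :
    volume (gapSet A S a b t) = ENNReal.ofReal (b - a - S.card * t) ^ A.card := by
  induction S using Finset.induction_on generalizing b with
  | empty => simp [volume_gapSet_empty]
  | insert i S hi ih =>
    rw [volume_gapSet_insert ((subset_insert _ _).trans hS) (hS (mem_insert_self _ _)) hi _ _ ht,
      ih ((subset_insert _ _).trans hS), card_insert_of_notMem hi]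
    congr 2
    push_cast
    ring

lemma two_point_mgf_le {p : ℝ} (hp : p ∈ Set.Ioo (0:ℝ) 1) (l : ℝ) :
    p + (1 - p) * Real.exp l ≤ Real.exp (l * (1 - p) + l ^ 2 / 8) := by
  let μ : Measure ℝ := ENNReal.ofReal p • Measure.dirac 0 + ENNReal.ofReal (1 - p) • Measure.dirac 1
  have h1 : 0 ≤ 1 - p := by linarith [hp.2]
  have hμ : IsProbabilityMeasure μ := ⟨by
    simp [μ, ← ENNReal.ofReal_add hp.1.le h1]⟩
  have hintg : ∀ f : ℝ → ℝ, ∫ x, f x ∂μ = p * f 0 + (1 - p) * f 1 := by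
    intro f
    have hd : ∀ a : ℝ, Integrable f (Measure.dirac a) := fun a =>
      integrable_dirac (by simp)
    rw [integral_add_measure ((hd 0).smul_measure (by simp)) ((hd 1).smul_measure (by simp))]
    simp [hp.1.le, h1]
  have hb : ∀ᵐ x ∂μ, x ∈ Set.Icc (0:ℝ) 1 := by
    rw [ae_add_measure_iff]
    constructor <;> refine Measure.ae_smul_measure ?_ _ <;> simp [ae_dirac_eq]
  have := (ProbabilityTheory.hasSubgaussianMGF_of_mem_Icc (X := id) aemeasurable_id hb).mgf_le l
  simp only [ProbabilityTheory.mgf, hintg, id] at this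
  norm_num at this
  have e1 := mul_le_mul_of_nonneg_right this (Real.exp_pos (l * (1 - p))).le
  rw [← Real.exp_add, add_mul, mul_assoc, mul_assoc, ← Real.exp_add, ← Real.exp_add] at e1
  rw [show l * (p - 1) + l * (1 - p) = 0 by ring, show l * p + l * (1 - p) = l by ring,
    show 1 / 4 * l ^ 2 / 2 + l * (1 - p) = l * (1 - p) + l ^ 2 / 8 by ring] at e1
  simpa using e1

lemma sum_prob_mul_exp (n : ℕ) (p l : ℝ) :
    ∑ A : Finset (Fin n), prob p A * Real.exp (l * A.card) = (p + (1 - p) * Real.exp l) ^ n := by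
  rw [add_comm, ← Fin.sum_pow_mul_eq_add_pow]
  refine sum_congr rfl fun A _ => ?_
  rw [prob, mul_pow, ← Real.exp_nat_mul, mul_comm l]
  ring

lemma sum_prob (n : ℕ) (p : ℝ) : ∑ A : Finset (Fin n), prob p A = 1 := by
  simpa using sum_prob_mul_exp n p 0

lemma prob_nonneg {n : ℕ} {p : ℝ} (hp : p ∈ Set.Ioo (0:ℝ) 1) (A : Finset (Fin n)) :
    0 ≤ prob p A :=
  mul_nonneg (pow_nonneg hp.1.le _) (pow_nonneg (by linarith [hp.2]) _)

/-- Hoeffding's inequality for the number of active sensors; the lower tail is `σ = -1`. -/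
lemma sum_prob_tail_le {n : ℕ} {p : ℝ} (hp : p ∈ Set.Ioo (0:ℝ) 1) {ε σ : ℝ} (hε : 0 < ε)
    (hσ : σ ^ 2 = 1) (s : Finset (Finset (Fin n)))
    (hs : ∀ A ∈ s, ε * n ≤ σ * (A.card - (1 - p) * n)) :
    ∑ A ∈ s, prob p A ≤ Real.exp (-(2 * ε ^ 2 * n)) := by
  have hexp : ∀ A ∈ s, prob p A ≤ prob p A *
      Real.exp (4 * ε * σ * A.card) * Real.exp (-(4 * ε * σ * (1 - p) + 4 * ε ^ 2) * n) := by
    intro A hA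
    rw [mul_assoc, ← Real.exp_add]
    refine le_mul_of_one_le_right (prob_nonneg hp A) (Real.one_le_exp ?_)
    nlinarith [mul_le_mul_of_nonneg_left (hs A hA) hε.le]
  calc ∑ A ∈ s, prob p A
      ≤ ∑ A ∈ s, prob p A *
        Real.exp (4 * ε * σ * A.card) * Real.exp (-(4 * ε * σ * (1 - p) + 4 * ε ^ 2) * n) :=
        sum_le_sum hexp
    _ ≤ ∑ A : Finset (Fin n), prob p A *
        Real.exp (4 * ε * σ * A.card) * Real.exp (-(4 * ε * σ * (1 - p) + 4 * ε ^ 2) * n) :=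
        sum_le_sum_of_subset_of_nonneg (subset_univ _) fun A _ _ =>
          mul_nonneg (mul_nonneg (prob_nonneg hp A) (Real.exp_pos _).le) (Real.exp_pos _).le
    _ = (p + (1 - p) * Real.exp (4 * ε * σ)) ^ n *
        Real.exp (-(4 * ε * σ * (1 - p) + 4 * ε ^ 2) * n) := by
        rw [← sum_mul, sum_prob_mul_exp]
    _ ≤ Real.exp (4 * ε * σ * (1 - p) + (4 * ε * σ) ^ 2 / 8) ^ n *
        Real.exp (-(4 * ε * σ * (1 - p) + 4 * ε ^ 2) * n) := by
        have h0 : 0 ≤ p + (1 - p) * Real.exp (4 * ε * σ) :=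
          add_nonneg hp.1.le (mul_nonneg (by linarith [hp.2]) (Real.exp_pos _).le)
        gcongr
        exact two_point_mgf_le hp _
    _ = Real.exp (-(2 * ε ^ 2 * n)) := by
        rw [← Real.exp_nat_mul, ← Real.exp_add, mul_pow, mul_pow, hσ]
        ring_nf

/-- The alternating binomial sum `∑ j, (-1)^j * (k.choose j) / (j + x)`. -/
noncomputable def altSum (k : ℕ) (x : ℝ) : ℝ :=
  ∑ j ∈ range (k + 1), (-1) ^ j * (k.choose j : ℝ) * (1 / (j + x))

lemma sum_range_choose_succ (k : ℕ) (g : ℕ → ℝ) :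
    ∑ j ∈ range (k + 2), (-1) ^ j * ((k + 1).choose j : ℝ) * g j =
      ∑ j ∈ range (k + 1), (-1) ^ j * (k.choose j : ℝ) * g j -
      ∑ j ∈ range (k + 1), (-1) ^ j * (k.choose j : ℝ) * g (j + 1) := by
  rw [sum_range_succ' _ (k + 1)]
  simp only [Nat.choose_succ_succ, Nat.cast_add, mul_add, add_mul, sum_add_distrib]
  have h : ∑ j ∈ range (k + 1), (-1) ^ j * (k.choose j : ℝ) * g j =
      ∑ j ∈ range (k + 1), (-1) ^ (j + 1) * (k.choose (j + 1) : ℝ) * g (j + 1) + g 0 := by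
    have := sum_range_succ' (fun j => (-1) ^ j * (k.choose j : ℝ) * g j) (k + 1)
    rw [sum_range_succ] at this
    simpa using this
  rw [h]
  have h2 : ∑ j ∈ range (k + 1), (-1) ^ (j + 1) * (k.choose j : ℝ) * g (j + 1) =
      -∑ j ∈ range (k + 1), (-1) ^ j * (k.choose j : ℝ) * g (j + 1) := by
    rw [← sum_neg_distrib]
    exact sum_congr rfl fun j _ => by ring
  rw [h2]
  simp
  ring

lemma altSum_succ (k : ℕ) (x : ℝ) : altSum (k + 1) x = altSum k x - altSum k (x + 1) := by
  simp only [altSum]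
  rw [sum_range_choose_succ k fun j => 1 / (j + x)]
  push_cast
  simp only [add_assoc, add_comm (1:ℝ)]

lemma altSum_succ_mul (k : ℕ) {x : ℝ} (hx : 0 < x) :
    altSum (k + 1) x * (x + k + 1) = altSum k x * (k + 1) := by
  suffices h : altSum k x * x = altSum k (x + 1) * (x + k + 1) by
    rw [altSum_succ]; linear_combination h
  induction k generalizing x with
  | zero => simp [altSum]; field_simp
  | succ k ih =>
    rw [altSum_succ, altSum_succ]
    have h1 := ih hx
    have h2 := ih (show 0 < x + 1 by linarith)
    push_cast
    linear_combination h1 - h2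

lemma altSum_one (k : ℕ) : altSum k 1 = 1 / (k + 1) := by
  induction k with
  | zero => simp [altSum]
  | succ k ih =>
    have := altSum_succ_mul k one_pos
    rw [ih] at this
    push_cast
    field_simp at this ⊢
    linarith

lemma H_succ (k : ℕ) : H (k + 1) = H k + 1 / (k + 1) := sum_range_succ _ _

lemma H_nonneg (k : ℕ) : 0 ≤ H k := sum_nonneg fun _ _ => by positivity

/-- The term `j = 0` is zero because `1 / 0 = 0`. -/
lemma altSum_zero (k : ℕ) : altSum k 0 = - H k := by
  induction k with
  | zero => simp [altSum, H]
  | succ k ih => rw [altSum_succ, ih, H_succ, zero_add, altSum_one]; ring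

lemma H_le_mul_altSum_half (k : ℕ) : H k ≤ k * altSum k (1 / 2) := by
  have hb : ∀ k : ℕ, altSum (k + 1) (1 / 2) * (2 * k + 3) = altSum k (1 / 2) * (2 * k + 2) := by
    intro k
    linear_combination 2 * altSum_succ_mul k (show (0:ℝ) < 1 / 2 by norm_num)
  have hlow : ∀ k : ℕ, 2 ≤ altSum k (1 / 2) * (k + 1) := by
    intro k
    induction k with
    | zero => simp [altSum]
    | succ k ih =>
      have := hb k
      push_cast
      have e : altSum (k + 1) (1 / 2) = altSum k (1 / 2) * (2 * k + 2) / (2 * k + 3) := by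
        field_simp; linarith
      rw [e, div_mul_eq_mul_div, le_div_iff₀ (by positivity)]
      have hk : (0:ℝ) ≤ k := k.cast_nonneg
      nlinarith
  induction k with
  | zero => simp [H]
  | succ k ih =>
    have e : altSum (k + 1) (1 / 2) = altSum k (1 / 2) * (2 * k + 2) / (2 * k + 3) := by
      have := hb k
      field_simp; linarith
    have h2 := hlow k
    have hk : (0:ℝ) ≤ k := k.cast_nonneg
    have hd : 1 / ((k:ℝ) + 1) ≤ altSum k (1 / 2) / 2 := by
      rw [div_le_iff₀ (by positivity)]; linarith
    have hpos : 0 ≤ altSum k (1 / 2) := by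
      by_contra! h
      nlinarith
    rw [H_succ, e]
    push_cast
    have : ((k:ℝ) + 1) * (altSum k (1 / 2) * (2 * k + 2) / (2 * k + 3)) =
        k * altSum k (1 / 2) + altSum k (1 / 2) / 2 + altSum k (1 / 2) * (1 / (2 * (2 * k + 3))) := by
      field_simp; ring
    rw [this]
    have : 0 ≤ altSum k (1 / 2) * (1 / (2 * (2 * k + 3))) := by positivity
    linarith

lemma lt_cost0_iff {n : ℕ} {A : Finset (Fin n)} (hA : A.Nonempty) (x : Fin n → ℝ) (t : ℝ) :
    t < cost0 x A ↔ ∃ s ∈ Set.Icc (0:ℝ) 1, ∀ j ∈ A, t < |s - x j| := by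
  have : Nonempty A := hA.to_subtype
  have hbdd : BddAbove (Set.range fun s : Set.Icc (0:ℝ) 1 => ⨅ j : A, |s.1 - x j.1|) := by
    obtain ⟨j, hj⟩ := hA
    refine ⟨1 + |x j|, ?_⟩
    rintro _ ⟨s, rfl⟩
    refine (ciInf_le (Set.finite_range _).bddBelow ⟨j, hj⟩).trans ((abs_sub _ _).trans ?_)
    gcongr
    exact abs_le.2 ⟨by linarith [s.2.1], s.2.2⟩
  rw [cost0, if_pos hA, lt_ciSup_iff hbdd, Subtype.exists]
  refine exists_congr fun s => ?_
  simp only [exists_prop]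
  refine and_congr_right fun _ => ⟨fun h j hj => ?_, fun h => ?_⟩
  · exact h.trans_le (ciInf_le (Set.finite_range _).bddBelow (⟨j, hj⟩ : A))
  · obtain ⟨j, hj⟩ := exists_eq_ciInf_of_finite (f := fun j : A => |s - x j.1|)
    rw [← hj]
    exact h j j.2

lemma cost0_nonneg {n : ℕ} (x : Fin n → ℝ) (A : Finset (Fin n)) : 0 ≤ cost0 x A := by
  unfold cost0
  split_ifs
  · exact Real.iSup_nonneg fun s => Real.iInf_nonneg fun j => abs_nonneg _
  · exact zero_le_one

lemma cost0_le_one {n : ℕ} {x : Fin n → ℝ} (hx : ∀ j, x j ∈ Set.Ioc (0:ℝ) 1)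
    (A : Finset (Fin n)) : cost0 x A ≤ 1 := by
  by_cases hA : A.Nonempty
  · by_contra! h
    obtain ⟨s, hs, h⟩ := (lt_cost0_iff hA x 1).1 h
    obtain ⟨j, hj⟩ := hA
    refine (h j hj).not_ge (abs_le.2 ⟨?_, ?_⟩) <;> linarith [hs.1, hs.2, (hx j).1, (hx j).2]
  · simp [cost0, hA]

lemma measurable_cost0 {n : ℕ} (A : Finset (Fin n)) :
    Measurable fun x : Fin n → ℝ => cost0 x A := by
  by_cases hA : A.Nonempty
  · refine measurable_of_Ioi fun t => IsOpen.measurableSet ?_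
    have : (fun x : Fin n → ℝ => cost0 x A) ⁻¹' Set.Ioi t =
        ⋃ s ∈ Set.Icc (0:ℝ) 1, ⋂ j ∈ A, {x | t < |s - x j|} := by
      ext x
      simp only [Set.mem_preimage, Set.mem_Ioi, lt_cost0_iff hA, Set.mem_iUnion, Set.mem_iInter,
        Set.mem_ofPred_eq, exists_prop]
    rw [this]
    exact isOpen_biUnion fun s _ => isOpen_biInter_finset fun j _ =>
      isOpen_lt continuous_const (by fun_prop)
  · simp [cost0, hA]

/-- The uniform distribution on `(0, 1]^n`. -/
noncomputable def cubeMeasure (n : ℕ) : Measure (Fin n → ℝ) :=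
  volume.restrict (Set.univ.pi fun _ => Set.Ioc (0:ℝ) 1)

instance (n : ℕ) : IsProbabilityMeasure (cubeMeasure n) :=
  ⟨by simp [cubeMeasure, volume_pi_pi]⟩

lemma ae_cubeMeasure (n : ℕ) : ∀ᵐ x ∂cubeMeasure n, ∀ j, x j ∈ Set.Ioc (0:ℝ) 1 := by
  filter_upwards [ae_restrict_mem (MeasurableSet.univ_pi fun _ => measurableSet_Ioc)] with x hx j
  exact hx j trivial

lemma integrable_cost0 {n : ℕ} (A : Finset (Fin n)) :
    Integrable (fun x => cost0 x A) (cubeMeasure n) := by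
  refine Integrable.of_bound (measurable_cost0 A).aestronglyMeasurable 1 ?_
  filter_upwards [ae_cubeMeasure n] with x hx
  rw [Real.norm_eq_abs, abs_of_nonneg (cost0_nonneg x A)]
  exact cost0_le_one hx A

lemma integral_cost0_eq {n : ℕ} (A : Finset (Fin n)) :
    ∫ x, cost0 x A ∂cubeMeasure n =
      ∫ t in (0:ℝ)..1, (cubeMeasure n).real {x | t < cost0 x A} := by
  rw [(integrable_cost0 A).integral_eq_integral_meas_lt
    (Filter.Eventually.of_forall fun x => cost0_nonneg x A),
    intervalIntegral.integral_of_le zero_le_one]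
  refine setIntegral_eq_of_subset_of_forall_sdiff_eq_zero measurableSet_Ioi
    Set.Ioc_subset_Ioi_self fun t ht => ?_
  have ht1 : 1 < t := by
    by_contra! h
    exact ht.2 ⟨ht.1, h⟩
  rw [measureReal_eq_zero_iff]
  refine measure_eq_zero_iff_ae_notMem.2 ?_
  filter_upwards [ae_cubeMeasure n] with x hx
  exact not_lt.2 ((cost0_le_one hx A).trans ht1.le)

lemma cubeMeasure_real_congr {n : ℕ} {A S : Finset (Fin n)} {a b t : ℝ} {s : Set (Fin n → ℝ)}
    (h : ∀ x : Fin n → ℝ, Set.InjOn x A →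
      (((∀ j, x j ∈ Set.Ioc (0:ℝ) 1) ∧ x ∈ s) ↔ x ∈ gapSet A S a b t)) (hs : MeasurableSet s) :
    (cubeMeasure n).real s = volume.real (gapSet A S a b t) := by
  rw [cubeMeasure, measureReal_restrict_apply hs]
  refine measureReal_congr ?_
  filter_upwards [ae_injective] with x hx
  refine propext (Iff.trans ?_ (h x hx.injOn))
  change x ∈ s ∩ Set.univ.pi _ ↔ _
  simp [Set.mem_pi, and_comm]

/-- The placements in which sensor `i` is followed by a stretch of length `t` in `[0, 1]` without
sensors of `A`, and all sensors of `A` lie to the right of `c`. -/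
def gapEvent {n : ℕ} (A : Finset (Fin n)) (t c : ℝ) (i : Fin n) : Set (Fin n → ℝ) :=
  {x | (x i + t ≤ 1 ∧ ∀ j ∈ A, x i < x j → x i + t < x j) ∧ ∀ j ∈ A, c < x j}

lemma measurableSet_gapEvent {n : ℕ} (A : Finset (Fin n)) (t c : ℝ) (i : Fin n) :
    MeasurableSet (gapEvent A t c i) := by
  have h1 : MeasurableSet {x : Fin n → ℝ | x i + t ≤ 1 ∧ ∀ j ∈ A, x i < x j → x i + t < x j} := by
    measurability
  have h2 : MeasurableSet {x : Fin n → ℝ | ∀ j ∈ A, c < x j} := by measurability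
  exact h1.inter h2

lemma measureReal_iInter_gapEvent {n : ℕ} {A S : Finset (Fin n)} (hS : S ⊆ A) (hne : S.Nonempty)
    {t c : ℝ} (ht : 0 < t) (hc : 0 ≤ c) :
    (cubeMeasure n).real (⋂ i ∈ S, gapEvent A t c i) = max (1 - c - S.card * t) 0 ^ A.card := by
  rw [cubeMeasure_real_congr (A := A) (S := S) (a := c) (b := 1) (t := t) (fun x hx => ?_)
    (S.measurableSet_biInter fun i _ => measurableSet_gapEvent A t c i), measureReal_def,
    volume_gapSet hS _ _ ht, ENNReal.toReal_pow, ENNReal.toReal_ofReal']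
  obtain ⟨i, hi⟩ := hne
  simp only [gapEvent, gapSet, Set.mem_iInter, Set.mem_ofPred_eq, Set.mem_Ioc]
  constructor
  · rintro ⟨h1, h2⟩
    exact ⟨hx, fun j _ => h1 j, fun j hj => ⟨(h2 i hi).2 j hj, (h1 j).2⟩, fun i hi => (h2 i hi).1⟩
  · rintro ⟨-, h1, h2, h3⟩
    refine ⟨fun j => ?_, fun i hi => ⟨h3 i hi, fun j hj => (h2 j hj).1⟩⟩
    by_cases hj : j ∈ A
    · exact ⟨hc.trans_lt (h2 j hj).1, (h2 j hj).2⟩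
    · exact h1 j hj

lemma measureReal_box {n : ℕ} (A : Finset (Fin n)) {a b : ℝ} (ha : 0 ≤ a) (hb : b ≤ 1) :
    (cubeMeasure n).real {x | ∀ j ∈ A, x j ∈ Set.Ioc a b} = max (b - a) 0 ^ A.card := by
  rw [cubeMeasure_real_congr (A := A) (S := ∅) (a := a) (b := b) (t := 0) (fun x hx => ?_)
    (by measurability), measureReal_def, volume_gapSet_empty, ENNReal.toReal_pow,
    ENNReal.toReal_ofReal']
  simp only [gapSet, Set.mem_ofPred_eq, Set.mem_Ioc]
  constructor
  · rintro ⟨h1, h2⟩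
    exact ⟨hx, fun j _ => h1 j, h2, by simp⟩
  · rintro ⟨-, h1, h2, -⟩
    refine ⟨fun j => ?_, h2⟩
    by_cases hj : j ∈ A
    · exact ⟨ha.trans_lt (h2 j hj).1, (h2 j hj).2.trans hb⟩
    · exact h1 j hj

/-- The probability that some sensor among `k` uniform ones is followed by an empty stretch of length
`2 * t` while all of them lie to the right of `e * t`. -/
noncomputable def gapTail (k : ℕ) (e t : ℝ) : ℝ :=
  - ∑ j ∈ range k, (-1) ^ (j + 1) * (k.choose (j + 1) : ℝ) * max (1 - (2 * (j + 1) + e) * t) 0 ^ k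

lemma sum_powerset_nonempty {n : ℕ} (A : Finset (Fin n)) (g : ℕ → ℝ) :
    ∑ u ∈ A.powerset with u.Nonempty, (-1 : ℝ) ^ (#u + 1) * g #u =
      - ∑ j ∈ range #A, (-1) ^ (j + 1) * ((#A).choose (j + 1) : ℝ) * g (j + 1) := by
  have h1 := sum_powerset_apply_card (x := A) (fun j => (-1 : ℝ) ^ (j + 1) * g j)
  rw [sum_range_succ'] at h1
  have h2 := sum_filter_add_sum_filter_not A.powerset (fun u => u.Nonempty)
    (fun u => (-1 : ℝ) ^ (#u + 1) * g #u)
  have h3 : {u ∈ A.powerset | ¬ u.Nonempty} = {∅} := by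
    ext u
    simp only [mem_filter, mem_powerset, not_nonempty_iff_eq_empty, mem_singleton]
    exact ⟨fun h => h.2, fun h => ⟨h ▸ empty_subset _, h⟩⟩
  rw [h3, h1] at h2
  simp only [sum_singleton, card_empty, nsmul_eq_mul, Nat.choose_zero_right, Nat.cast_one,
    one_mul] at h2
  rw [← sum_neg_distrib, add_right_cancel h2]
  exact sum_congr rfl fun j _ => by ring

lemma measureReal_iUnion_gapEvent {n : ℕ} (A : Finset (Fin n)) {e t : ℝ} (he : 0 ≤ e)
    (ht : 0 < t) :
    (cubeMeasure n).real (⋃ i ∈ A, gapEvent A (2 * t) (e * t) i) = gapTail #A e t := by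
  rw [measureReal_biUnion_eq_sum_powerset fun i _ => measurableSet_gapEvent _ _ _ i, gapTail]
  have := sum_powerset_nonempty A fun j => max (1 - (2 * j + e) * t) 0 ^ #A
  push_cast at this
  rw [← this]
  refine sum_congr rfl fun u hu => ?_
  rw [mem_filter, mem_powerset] at hu
  rw [measureReal_iInter_gapEvent hu.1 hu.2 (by positivity) (by positivity)]
  ring_nf

lemma integral_max_pow {k : ℕ} (hk : k ≠ 0) {d : ℝ} (hd : 1 ≤ d) :
    ∫ t in (0:ℝ)..1, max (1 - d * t) 0 ^ k = 1 / (d * (k + 1)) := by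
  have hd0 : 0 < d := by linarith
  have hle : 1 / d ≤ 1 := (div_le_one hd0).2 hd
  have hintg : ∀ a b : ℝ, IntervalIntegrable (fun t => max (1 - d * t) 0 ^ k) volume a b :=
    fun a b => Continuous.intervalIntegrable (by fun_prop) _ _
  rw [← intervalIntegral.integral_add_adjacent_intervals (hintg 0 (1 / d)) (hintg (1 / d) 1)]
  have h1 : ∫ t in (0:ℝ)..(1 / d), max (1 - d * t) 0 ^ k = 1 / (d * (k + 1)) := by
    have : ∫ t in (0:ℝ)..(1 / d), max (1 - d * t) 0 ^ k = ∫ t in (0:ℝ)..(1 / d), (1 - d * t) ^ k := by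
      refine intervalIntegral.integral_congr fun t ht => ?_
      rw [Set.uIcc_of_le (by positivity), Set.mem_Icc, le_div_iff₀ hd0] at ht
      rw [max_eq_left (by linarith [ht.2])]
    rw [this, intervalIntegral.integral_comp_sub_mul (fun u => u ^ k) hd0.ne' 1, integral_pow]
    have : 1 - d * (1 / d) = 0 := by field_simp; simp
    rw [this]
    simp
    ring
  have h2 : ∫ t in (1 / d)..1, max (1 - d * t) 0 ^ k = 0 := by
    refine (intervalIntegral.integral_congr fun t ht => ?_).trans intervalIntegral.integral_zero
    rw [Set.uIcc_of_le hle, Set.mem_Icc, div_le_iff₀ hd0] at ht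
    rw [max_eq_right (by linarith [ht.1]), zero_pow hk]
  rw [h1, h2, add_zero]

lemma integral_gapTail {k : ℕ} (hk : k ≠ 0) {e : ℝ} (he : 0 ≤ e) :
    ∫ t in (0:ℝ)..1, gapTail k e t = (1 / (e / 2) - altSum k (e / 2)) / (2 * (k + 1)) := by
  unfold gapTail
  rw [intervalIntegral.integral_neg, intervalIntegral.integral_finsetSum]
  · simp only [intervalIntegral.integral_const_mul]
    rw [altSum, sum_range_succ']
    have : ∀ j : ℕ, ∫ t in (0:ℝ)..1, max (1 - (2 * ((j:ℝ) + 1) + e) * t) 0 ^ k =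
        1 / ((j + 1 : ℕ) + e / 2) / (2 * (k + 1)) := by
      intro j
      rw [integral_max_pow hk (by linarith [(j.cast_nonneg : (0:ℝ) ≤ j)])]
      push_cast
      field_simp
    simp only [this, ← mul_div_assoc]
    rw [← sum_div, ← neg_div]
    simp
  · intro j _
    exact Continuous.intervalIntegrable (by fun_prop) _ _

lemma gapEvent_subset {n : ℕ} {A : Finset (Fin n)} {x : Fin n → ℝ} {i : Fin n} (hi : i ∈ A)
    (hx : ∀ j, x j ∈ Set.Ioc (0:ℝ) 1)
    {t c : ℝ} (ht : 0 < t) (h : x ∈ gapEvent A (2 * t) c i) : t < cost0 x A := by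
  rw [lt_cost0_iff ⟨i, hi⟩]
  obtain ⟨⟨h1, h2⟩, -⟩ := h
  by_cases hne : ({j ∈ A | x i < x j} : Finset _).Nonempty
  · obtain ⟨k, hk, hmin⟩ := exists_min_image _ x hne
    rw [mem_filter] at hk
    have hgap := h2 k hk.1 hk.2
    refine ⟨(x i + x k) / 2, ⟨by linarith [(hx i).1, (hx k).1], by linarith [(hx i).2, (hx k).2]⟩,
      fun j hj => lt_abs.2 ?_⟩
    by_cases hij : x i < x j
    · right
      linarith [hmin j (mem_filter.2 ⟨hj, hij⟩)]
    · left
      linarith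
  · refine ⟨1, ⟨zero_le_one, le_rfl⟩, fun j hj => lt_abs.2 (Or.inl ?_)⟩
    have : x j ≤ x i := by
      by_contra! h
      exact hne ⟨j, mem_filter.2 ⟨hj, h⟩⟩
    linarith

lemma mem_of_lt_cost0 {n : ℕ} {A : Finset (Fin n)} (hA : A.Nonempty) {x : Fin n → ℝ}
    (hx : ∀ j, x j ∈ Set.Ioc (0:ℝ) 1) {t : ℝ} (ht : 0 < t) (h : t < cost0 x A) :
    x ∈ (⋃ i ∈ A, gapEvent A (2 * t) (0 * t) i) ∪ ({x | ∀ j ∈ A, x j ∈ Set.Ioc t 1} ∪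
      {x | ∀ j ∈ A, x j ∈ Set.Ioc 0 (1 - t)}) := by
  obtain ⟨s, hs, h⟩ := (lt_cost0_iff hA x t).1 h
  by_cases hne : ({j ∈ A | x j ≤ s} : Finset _).Nonempty
  · obtain ⟨i, hi, hmax⟩ := exists_max_image _ x hne
    rw [mem_filter] at hi
    by_cases hk : ∃ k ∈ A, s < x k
    · left
      obtain ⟨k, hkA, hk⟩ := hk
      simp only [Set.mem_iUnion]
      have hright : ∀ j ∈ A, s < x j → s + t < x j := fun j hj hsj => by
        rcases lt_abs.1 (h j hj) with h' | h' <;> linarith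
      have hleft : x i < s - t := by
        rcases lt_abs.1 (h i hi.1) with h' | h' <;> linarith
      refine ⟨i, hi.1, ⟨by linarith [hright k hkA hk, (hx k).2], fun j hj hij => ?_⟩,
        fun j _ => by simpa using (hx j).1⟩
      by_cases hjs : x j ≤ s
      · linarith [hmax j (mem_filter.2 ⟨hj, hjs⟩)]
      · linarith [hright j hj (not_le.1 hjs)]
    · push Not at hk
      refine Or.inr (Or.inr fun j hj => ⟨(hx j).1, ?_⟩)
      rcases lt_abs.1 (h j hj) with h' | h' <;> linarith [hk j hj, hs.2]
  · refine Or.inr (Or.inl fun j hj => ⟨?_, (hx j).2⟩)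
    have : s < x j := by
      by_contra! h'
      exact hne ⟨j, mem_filter.2 ⟨hj, h'⟩⟩
    rcases lt_abs.1 (h j hj) with h' | h' <;> linarith [hs.1]

lemma continuous_gapTail (k : ℕ) (e : ℝ) : Continuous (gapTail k e) := by
  unfold gapTail
  fun_prop

lemma intervalIntegrable_measureReal_lt {n : ℕ} (A : Finset (Fin n)) :
    IntervalIntegrable (fun t => (cubeMeasure n).real {x | t < cost0 x A}) volume 0 1 :=
  Antitone.intervalIntegrable fun _ _ h => measureReal_mono fun _ hx => h.trans_lt hx

lemma integral_cost0_le {n : ℕ} {A : Finset (Fin n)} (hA : A.Nonempty) :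
    ∫ x, cost0 x A ∂cubeMeasure n ≤ (H #A + 4) / (2 * #A + 2) := by
  have hk : #A ≠ 0 := hA.card_pos.ne'
  have hintg : ∀ f : ℝ → ℝ, Continuous f → IntervalIntegrable f volume 0 1 :=
    fun f hf => hf.intervalIntegrable _ _
  have hval : ∫ t in (0:ℝ)..1, (gapTail #A 0 t + 2 * max (1 - 1 * t) 0 ^ #A) =
      (H #A + 4) / (2 * #A + 2) := by
    rw [intervalIntegral.integral_add (hintg _ (continuous_gapTail _ _)) (hintg _ (by fun_prop)),
      intervalIntegral.integral_const_mul, integral_gapTail hk le_rfl, integral_max_pow hk le_rfl,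
      zero_div, altSum_zero, div_zero]
    field_simp
    ring
  rw [integral_cost0_eq, ← hval]
  refine intervalIntegral.integral_mono_on_of_le_Ioo zero_le_one
    (intervalIntegrable_measureReal_lt A)
    (hintg _ ((continuous_gapTail _ _).add (by fun_prop))) fun t ht => ?_
  have hsub : (cubeMeasure n).real {x | t < cost0 x A} ≤ (cubeMeasure n).real
      ((⋃ i ∈ A, gapEvent A (2 * t) (0 * t) i) ∪ ({x | ∀ j ∈ A, x j ∈ Set.Ioc t 1} ∪
        {x | ∀ j ∈ A, x j ∈ Set.Ioc 0 (1 - t)})) := by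
    refine ENNReal.toReal_mono (measure_ne_top _ _) (measure_mono_ae ?_)
    filter_upwards [ae_cubeMeasure n] with x hx h
    exact mem_of_lt_cost0 hA hx ht.1 h
  refine hsub.trans ((measureReal_union_le _ _).trans ?_)
  rw [measureReal_iUnion_gapEvent A le_rfl ht.1]
  gcongr
  refine (measureReal_union_le _ _).trans ?_
  rw [measureReal_box A ht.1.le le_rfl, measureReal_box A le_rfl (by linarith [ht.1])]
  apply le_of_eq
  ring_nf

lemma le_integral_cost0 {n : ℕ} {A : Finset (Fin n)} (hA : A.Nonempty) :
    H #A / (2 * #A) ≤ ∫ x, cost0 x A ∂cubeMeasure n := by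
  have hk : #A ≠ 0 := hA.card_pos.ne'
  have hintg : ∀ f : ℝ → ℝ, Continuous f → IntervalIntegrable f volume 0 1 :=
    fun f hf => hf.intervalIntegrable _ _
  have hg := fun e => continuous_gapTail #A e
  have hval : ∫ t in (0:ℝ)..1, (gapTail #A 0 t + max (1 - 1 * t) 0 ^ #A - gapTail #A 1 t) =
      (H #A + altSum #A (1 / 2)) / (2 * (#A + 1)) := by
    rw [intervalIntegral.integral_sub ((hintg _ (hg 0)).add (hintg _ (by fun_prop))) (hintg _ (hg 1)),
      intervalIntegral.integral_add (hintg _ (hg 0)) (hintg _ (by fun_prop)),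
      integral_gapTail hk le_rfl, integral_gapTail hk zero_le_one, integral_max_pow hk le_rfl,
      zero_div, altSum_zero, div_zero]
    field_simp
    ring
  have hle : H #A / (2 * #A) ≤ (H #A + altSum #A (1 / 2)) / (2 * (#A + 1)) := by
    have h := H_le_mul_altSum_half #A
    have hpos : (0:ℝ) < #A := by exact_mod_cast hA.card_pos
    rw [div_le_div_iff₀ (by positivity) (by positivity)]
    linarith
  rw [integral_cost0_eq]
  refine hle.trans ?_
  rw [← hval]
  refine intervalIntegral.integral_mono_on_of_le_Ioo zero_le_one
    (hintg _ (((hg 0).add (by fun_prop)).sub (hg 1)))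
    (intervalIntegrable_measureReal_lt A) fun t ht => ?_
  set L : Set (Fin n → ℝ) := {x | ∀ j ∈ A, x j ∈ Set.Ioc t 1} with hL
  have hLm : MeasurableSet L := by measurability
  have hinter : (cubeMeasure n).real ((⋃ i ∈ A, gapEvent A (2 * t) (0 * t) i) ∩ L) ≤
      gapTail #A 1 t := by
    rw [← measureReal_iUnion_gapEvent A zero_le_one ht.1]
    refine measureReal_mono ?_ (measure_ne_top _ _)
    rintro x ⟨hx, hxL⟩
    simp only [Set.mem_iUnion] at hx ⊢
    obtain ⟨i, hi, hx⟩ := hx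
    exact ⟨i, hi, hx.1, fun j hj => by simpa using (hxL j hj).1⟩
  have hunion := measureReal_union_add_inter (μ := cubeMeasure n)
    (s := ⋃ i ∈ A, gapEvent A (2 * t) (0 * t) i) hLm (measure_ne_top _ _) (measure_ne_top _ _)
  rw [measureReal_iUnion_gapEvent A le_rfl ht.1, hL, measureReal_box A ht.1.le le_rfl, ← hL]
    at hunion
  have hsub : (cubeMeasure n).real ((⋃ i ∈ A, gapEvent A (2 * t) (0 * t) i) ∪ L) ≤
      (cubeMeasure n).real {x | t < cost0 x A} := by
    refine ENNReal.toReal_mono (measure_ne_top _ _) (measure_mono_ae ?_)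
    filter_upwards [ae_cubeMeasure n] with x hx h
    rcases h with h | h
    · simp only [Set.mem_iUnion] at h
      obtain ⟨i, hi, h⟩ := h
      exact gapEvent_subset hi hx ht.1 h
    · refine (lt_cost0_iff hA x t).2 ⟨0, ⟨le_rfl, zero_le_one⟩, fun j hj => lt_abs.2 (Or.inr ?_)⟩
      linarith [(h j hj).1]
  rw [one_mul]
  linarith

lemma randExp_eq (n : ℕ) (p : ℝ) :
    randExp n p = ∑ A : Finset (Fin n), prob p A * ∫ x, cost0 x A ∂cubeMeasure n := by
  have h : randExp n p = ∫ x, expCost p x ∂cubeMeasure n := by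
    rw [randExp, cubeMeasure]
    refine setIntegral_congr_set ?_
    rw [Set.pi_univ_Icc, volume_pi]
    exact Measure.univ_pi_Ioc_ae_eq_Icc.symm
  rw [h]
  unfold expCost
  rw [integral_finsetSum _ fun A _ => (integrable_cost0 A).const_mul _]
  simp only [integral_const_mul]

lemma integral_cost0_empty (n : ℕ) : ∫ x, cost0 x ∅ ∂cubeMeasure n = 1 := by
  simp [cost0]

lemma integral_cost0_le_one {n : ℕ} (A : Finset (Fin n)) :
    ∫ x, cost0 x A ∂cubeMeasure n ≤ 1 := by
  have := integral_mono_ae (integrable_cost0 A) (integrable_const (1:ℝ))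
    (by filter_upwards [ae_cubeMeasure n] with x hx using cost0_le_one hx A)
  simpa using this

lemma integral_cost0_nonneg {n : ℕ} (A : Finset (Fin n)) :
    0 ≤ ∫ x, cost0 x A ∂cubeMeasure n :=
  integral_nonneg fun x => cost0_nonneg x A

lemma H_le_self (k : ℕ) : H k ≤ k := by
  refine (sum_le_card_nsmul _ _ 1 fun i _ => ?_).trans (by simp)
  rw [div_le_one (by positivity)]
  linarith [(i.cast_nonneg : (0:ℝ) ≤ i)]

lemma H_div_antitone {k m : ℕ} (hk : 1 ≤ k) (h : k ≤ m) : H m / (2 * m) ≤ H k / (2 * k) := by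
  have hlow : ∀ k : ℕ, (k:ℝ) / (k + 1) ≤ H k := by
    intro k
    induction k with
    | zero => simp [H]
    | succ k ih =>
      rw [H_succ]
      refine le_trans ?_ (add_le_add_left ih _)
      push_cast
      rw [← add_div]
      gcongr
      linarith
  induction m, h using Nat.le_induction with
  | base => exact le_rfl
  | succ m hm ih =>
    refine le_trans ?_ ih
    have hpos : (0:ℝ) < m := by exact_mod_cast hk.trans hm
    have := hlow m
    rw [H_succ, div_le_div_iff₀ (by positivity) (by positivity)]
    push_cast
    field_simp at this ⊢
    nlinarith

lemma H_add_four_div_antitone : Antitone fun k : ℕ => (H k + 4) / (2 * (k:ℝ) + 2) := by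
  refine antitone_nat_of_succ_le fun k => ?_
  have h := H_nonneg k
  have hk : 1 / ((k:ℝ) + 1) * (2 * k + 2) = 2 := by field_simp
  rw [H_succ, div_le_div_iff₀ (by positivity) (by positivity)]
  push_cast
  nlinarith

/-- Hoeffding-type bounds on the expected cost of the random
placement: for `ε ∈ (0,p)`,
`E[C(x^rand)] ≥ (1 - e^{-2ε²n}) H_{⌈(1-p+ε)n⌉} / (2⌈(1-p+ε)n⌉)`, and for
`ε ∈ (0,1-p)`,
`E[C(x^rand)] ≤ e^{-2ε²n} + (H_{⌈(1-p-ε)n⌉} + 4)/(2⌈(1-p-ε)n⌉ + 2)`. -/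
theorem randExp_bounds {n : ℕ} (hn : 1 ≤ n) (p : ℝ)
    (hp : p ∈ Set.Ioo (0:ℝ) 1) :
    (∀ ε : ℝ, 0 < ε → ε < p →
      (1 - Real.exp (-(2 * ε ^ 2 * n))) *
          (H ⌈(1 - p + ε) * n⌉₊ / (2 * (⌈(1 - p + ε) * n⌉₊ : ℝ)))
        ≤ randExp n p) ∧
    (∀ ε : ℝ, 0 < ε → ε < 1 - p →
      randExp n p ≤ Real.exp (-(2 * ε ^ 2 * n)) +
        (H ⌈(1 - p - ε) * n⌉₊ + 4) / (2 * (⌈(1 - p - ε) * n⌉₊ : ℝ) + 2)) := by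
  have hn0 : (0:ℝ) < n := by exact_mod_cast hn
  rw [randExp_eq]
  refine ⟨fun ε hε _ => ?_, fun ε hε hεp => ?_⟩
  · set M := ⌈(1 - p + ε) * n⌉₊
    have hpos : 0 < (1 - p + ε) * n := mul_pos (by linarith [hp.2]) hn0
    have hM1 : 1 ≤ M := Nat.ceil_pos.2 hpos
    have htail : ∑ A : Finset (Fin n) with ¬ #A ≤ M, prob p A ≤ Real.exp (-(2 * ε ^ 2 * n)) := by
      refine sum_prob_tail_le hp hε (one_pow 2) _ fun A hA => ?_
      have := Nat.lt_of_ceil_lt (not_le.1 (mem_filter.1 hA).2)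
      linarith
    have hsum := sum_filter_add_sum_filter_not univ (fun A : Finset (Fin n) => #A ≤ M) (prob p)
    rw [sum_prob] at hsum
    have hc : 0 ≤ H M / (2 * M) := div_nonneg (H_nonneg M) (by positivity)
    calc (1 - Real.exp (-(2 * ε ^ 2 * n))) * (H M / (2 * M))
        ≤ (∑ A : Finset (Fin n) with #A ≤ M, prob p A) * (H M / (2 * M)) := by
          gcongr
          linarith
      _ = ∑ A : Finset (Fin n) with #A ≤ M, prob p A * (H M / (2 * M)) := sum_mul ..
      _ ≤ ∑ A : Finset (Fin n) with #A ≤ M, prob p A * ∫ x, cost0 x A ∂cubeMeasure n := by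
          refine sum_le_sum fun A hA => mul_le_mul_of_nonneg_left ?_ (prob_nonneg hp A)
          rcases A.eq_empty_or_nonempty with rfl | hne
          · rw [integral_cost0_empty]
            refine div_le_one_of_le₀ ?_ (by positivity)
            linarith [H_le_self M, (M.cast_nonneg : (0:ℝ) ≤ M)]
          · exact (H_div_antitone hne.card_pos (mem_filter.1 hA).2).trans (le_integral_cost0 hne)
      _ ≤ _ := sum_le_sum_of_subset_of_nonneg (filter_subset _ _) fun A _ _ =>
          mul_nonneg (prob_nonneg hp A) (integral_cost0_nonneg A)
  · set M := ⌈(1 - p - ε) * n⌉₊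
    have hM1 : 1 ≤ M := Nat.ceil_pos.2 (mul_pos (by linarith) hn0)
    have htail : ∑ A : Finset (Fin n) with #A < M, prob p A ≤ Real.exp (-(2 * ε ^ 2 * n)) := by
      refine sum_prob_tail_le (σ := -1) hp hε (by norm_num) _ fun A hA => ?_
      have := Nat.lt_ceil.1 (mem_filter.1 hA).2
      linarith
    have hc : 0 ≤ (H M + 4) / (2 * (M:ℝ) + 2) :=
      div_nonneg (by linarith [H_nonneg M]) (by positivity)
    rw [← sum_filter_add_sum_filter_not univ (fun A : Finset (Fin n) => #A < M)]
    refine add_le_add (le_trans (sum_le_sum fun A _ => ?_) htail) ?_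
    · exact mul_le_of_le_one_right (prob_nonneg hp A) (integral_cost0_le_one A)
    · calc ∑ A : Finset (Fin n) with ¬ #A < M, prob p A * ∫ x, cost0 x A ∂cubeMeasure n
          ≤ ∑ A : Finset (Fin n) with ¬ #A < M, prob p A * ((H M + 4) / (2 * (M:ℝ) + 2)) := by
            refine sum_le_sum fun A hA => mul_le_mul_of_nonneg_left ?_ (prob_nonneg hp A)
            have hMA := not_lt.1 (mem_filter.1 hA).2
            exact (integral_cost0_le (card_pos.1 (hM1.trans hMA))).trans
              (H_add_four_div_antitone hMA)
        _ ≤ ∑ A : Finset (Fin n), prob p A * ((H M + 4) / (2 * (M:ℝ) + 2)) :=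
            sum_le_sum_of_subset_of_nonneg (filter_subset _ _) fun A _ _ =>
              mul_nonneg (prob_nonneg hp A) hc
        _ = _ := by rw [← sum_mul, sum_prob, one_mul]
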